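/- Fix y > 0 and c > 1. Define Q₊(y, X, c) = (1/X) · Σ_{N ∈ ℤ, X ≤ N ≤ cX, N ≢ 2 (mod 4)} Σ_{χ ∈ D₊(N)} χ(⌈yX⌉^𝔭)/τ(χ) and E₊(y, X, c) = (1/X) · Σ_{N ∈ ℤ, X ≤ N ≤ cX, N ≢ 2 (mod 4)} (1/N) · Σ_{χ ∈ I₊(N)} τ(χ̄) · χ(⌈yX⌉^𝔭). Then lim_{X → ∞} (Q₊(y, X, c) + E₊(y, X, c)) = (5/π²) · ∫_1^c cos(2πy/x) dx. -/

import Mathlib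

open Filter Topology Finset

/-- `⌈x⌉^𝔭`: the smallest prime number that is `≥ x`. -/
noncomputable def leastPrime (x : ℝ) : ℕ := sInf {p : ℕ | p.Prime ∧ x ≤ (p : ℝ)}

/-- The Gauss sum `τ(χ) = Σ_{b=1}^{N} χ(b) e^{2πib/N}`. -/
noncomputable def gaussSum' {N : ℕ} (χ : DirichletCharacter ℂ N) : ℂ :=
  ∑ b ∈ Finset.Icc 1 N,
    χ ((b : ℕ) : ZMod N) * Complex.exp (2 * Real.pi * Complex.I * (b : ℂ) / (N : ℂ))

/-- The Gauss sum `τ(χ̄)` of the complex conjugate character. -/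
noncomputable def gaussSumConj {N : ℕ} (χ : DirichletCharacter ℂ N) : ℂ :=
  ∑ b ∈ Finset.Icc 1 N,
    (starRingEnd ℂ) (χ ((b : ℕ) : ZMod N)) *
      Complex.exp (2 * Real.pi * Complex.I * (b : ℂ) / (N : ℂ))

/-- `Q₊(y, X, c)`: sum over primitive even characters of conductor `N ∈ [X, cX]`,
`N ≢ 2 (mod 4)`. -/
noncomputable def Qplus (y X c : ℝ) : ℂ :=
  (Complex.ofReal (1 / X)) *
    ∑ N ∈ (Finset.range (Nat.floor (c * X) + 1)).filter
        (fun N : ℕ => 0 < N ∧ X ≤ (N : ℝ) ∧ (N : ℝ) ≤ c * X ∧ N % 4 ≠ 2),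
      ∑ᶠ χ ∈ {χ : DirichletCharacter ℂ N | χ.IsPrimitive ∧ χ (-1) = 1},
        χ ((leastPrime (y * X) : ℕ) : ZMod N) / gaussSum' χ

/-- `E₊(y, X, c)`: sum over imprimitive non-principal even characters mod
`N ∈ [X, cX]`, `N ≢ 2 (mod 4)`. -/
noncomputable def Eplus (y X c : ℝ) : ℂ :=
  (Complex.ofReal (1 / X)) *
    ∑ N ∈ (Finset.range (Nat.floor (c * X) + 1)).filter
        (fun N : ℕ => 0 < N ∧ X ≤ (N : ℝ) ∧ (N : ℝ) ≤ c * X ∧ N % 4 ≠ 2),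
      (Complex.ofReal (1 / (N : ℝ))) *
        ∑ᶠ χ ∈ {χ : DirichletCharacter ℂ N | ¬χ.IsPrimitive ∧ χ ≠ 1 ∧ χ (-1) = 1},
          gaussSumConj χ * χ ((leastPrime (y * X) : ℕ) : ZMod N)

/-- Half of the Fejér kernel of width `T`, as a cosine integral. -/
noncomputable def fejer (T u : ℝ) : ℝ := ∫ t in (0 : ℝ)..T, (1 - t / T) * Real.cos (t * u)

lemma fejer_eq {T u : ℝ} (hT : 0 < T) (hu : u ≠ 0) :
    fejer T u = (1 - Real.cos (T * u)) / (T * u ^ 2) := by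
  have hd : ∀ t ∈ Set.uIcc 0 T, HasDerivAt
      (fun t : ℝ => (1 - t / T) * (Real.sin (t * u) / u) - Real.cos (t * u) / (T * u ^ 2))
      ((1 - t / T) * Real.cos (t * u)) t := by
    intro t _
    have h1 : HasDerivAt (fun t : ℝ => t * u) u t := by
      simpa using (hasDerivAt_id t).mul_const u
    have h2 : HasDerivAt (fun t : ℝ => 1 - t / T) (-(1 / T)) t :=
      ((hasDerivAt_id t).div_const T).const_sub 1
    convert! (h2.mul (h1.sin.div_const u)).sub (h1.cos.div_const (T * u ^ 2)) using 1
    field_simp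
    ring
  rw [fejer, intervalIntegral.integral_eq_sub_of_hasDerivAt hd
    (Continuous.intervalIntegrable (by fun_prop) _ _)]
  field_simp
  simp
  ring

lemma fejer_nonneg_of_ne {T u : ℝ} (hT : 0 < T) (hu : u ≠ 0) : 0 ≤ fejer T u := by
  rw [fejer_eq hT hu]
  have := Real.cos_le_one (T * u)
  positivity [sub_nonneg.2 this]

lemma abs_fejer_le {T : ℝ} (hT : 0 < T) (u : ℝ) : |fejer T u| ≤ T := by
  have h := intervalIntegral.norm_integral_le_of_norm_le_const (a := 0) (b := T) (C := 1)
    (f := fun t => (1 - t / T) * Real.cos (t * u)) (by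
      intro t ht
      rw [Set.uIoc_of_le hT.le] at ht
      have h1 : 0 ≤ t / T := div_nonneg ht.1.le hT.le
      have h2 : t / T ≤ 1 := (div_le_one hT).2 ht.2
      rw [norm_mul, Real.norm_eq_abs, Real.norm_eq_abs, abs_of_nonneg (by linarith)]
      have := Real.abs_cos_le_one (t * u)
      nlinarith [abs_nonneg (Real.cos (t * u))])
  simpa [fejer, abs_of_pos hT] using h

lemma integral_one_sub_div {T : ℝ} (hT : 0 < T) : ∫ t in (0 : ℝ)..T, (1 - t / T) = T / 2 := by
  rw [intervalIntegral.integral_sub (by simp) (Continuous.intervalIntegrable (by fun_prop) _ _)]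
  simp
  field_simp
  norm_num

lemma fejer_nonneg {T : ℝ} (hT : 0 < T) (u : ℝ) : 0 ≤ fejer T u := by
  rcases eq_or_ne u 0 with rfl | hu
  · simp only [fejer, mul_zero, Real.cos_zero, mul_one, integral_one_sub_div hT]
    positivity
  · exact fejer_nonneg_of_ne hT hu

lemma fejer_le_div {T u : ℝ} (hT : 0 < T) (hu : u ≠ 0) : fejer T u ≤ 2 / (T * u ^ 2) := by
  rw [fejer_eq hT hu]
  have := Real.neg_one_le_cos (T * u)
  gcongr
  linarith

lemma le_fejer {T u : ℝ} (hT : 0 < T) (hu : |T * u| ≤ 1) : T / 4 ≤ fejer T u := by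
  have : T / 4 = ∫ t in (0 : ℝ)..T, (1 - t / T) * (1 / 2) := by
    rw [intervalIntegral.integral_mul_const, integral_one_sub_div hT]; ring
  rw [this, fejer]
  apply intervalIntegral.integral_mono_on hT.le
    (Continuous.intervalIntegrable (by fun_prop) _ _)
    (Continuous.intervalIntegrable (by fun_prop) _ _)
  intro t ht
  have h2 : t / T ≤ 1 := (div_le_one hT).2 ht.2
  apply mul_le_mul_of_nonneg_left _ (by linarith)
  have h3 : (t * u) ^ 2 ≤ 1 := by
    have : |t * u| ≤ 1 := by
      refine le_trans ?_ hu
      rw [abs_mul, abs_mul, abs_of_nonneg ht.1, abs_of_pos hT]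
      exact mul_le_mul_of_nonneg_right ht.2 (abs_nonneg _)
    rw [← sq_abs]; nlinarith [abs_nonneg (t * u)]
  have := Real.one_sub_sq_div_two_le_cos (x := t * u)
  linarith

lemma re_integral_exp_eq_fejer (T u : ℝ) :
    (∫ t in (0 : ℝ)..T, ((1 - t / T : ℝ) : ℂ) * Complex.exp (Complex.I * t * u)).re
      = fejer T u := by
  have h := Complex.reCLM.intervalIntegral_comp_comm (a := 0) (b := T) (μ := MeasureTheory.volume)
    (f := fun t : ℝ => ((1 - t / T : ℝ) : ℂ) * Complex.exp (Complex.I * t * u))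
    (Continuous.intervalIntegrable (by fun_prop) _ _)
  simp only [Complex.reCLM_apply] at h
  rw [← h, fejer]
  congr 1 with t
  rw [Complex.re_ofReal_mul, show Complex.I * t * u = ((t * u : ℝ) : ℂ) * Complex.I by
    push_cast; ring, Complex.exp_ofReal_mul_I_re]

lemma fejer_neg (T u : ℝ) : fejer T (-u) = fejer T u := by
  simp [fejer]

open ArithmeticFunction in
/-- The continuous function on `1 ≤ re s` which is `-ζ'/ζ(s) - 1/(s-1)` for `1 < re s`. -/
lemma exists_continuousOn_LSeries_vonMangoldt_sub :
    ∃ F : ℂ → ℂ, ContinuousOn F {s | 1 ≤ s.re} ∧ ∀ s : ℂ, 1 < s.re →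
      F s = LSeries (fun n => (vonMangoldt n : ℂ)) s - 1 / (s - 1) := by
  refine ⟨vonMangoldt.LFunctionResidueClassAux (1 : ZMod 1),
    vonMangoldt.continuousOn_LFunctionResidueClassAux _, fun s hs => ?_⟩
  rw [vonMangoldt.eqOn_LFunctionResidueClassAux isUnit_one hs]
  have : (fun n => ((vonMangoldt.residueClass (1 : ZMod 1) n : ℝ) : ℂ))
      = fun n => (vonMangoldt n : ℂ) := by
    ext n
    simp [vonMangoldt.residueClass, Subsingleton.elim (n : ZMod 1) 1]
  rw [this]
  simp

open ArithmeticFunction in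
lemma hasSum_vonMangoldt_mul_fejer {T δ : ℝ} (hT : 0 < T) (hδ : 0 < δ) (L : ℝ) :
    HasSum (fun n : ℕ => vonMangoldt n * (n : ℝ) ^ (-(1 + δ)) * fejer T (Real.log n - L))
      (∫ t in (0 : ℝ)..T, ((1 - t / T : ℝ) : ℂ) * Complex.exp (Complex.I * t * L) *
        LSeries (fun n => (vonMangoldt n : ℂ)) (1 + δ + Complex.I * t)).re := by
  have hs : ∀ t : ℝ, 1 < (1 + δ + Complex.I * t : ℂ).re := by intro t; simp [hδ]
  have hsum : Summable fun n : ℕ => vonMangoldt n * (n : ℝ) ^ (-(1 + δ)) := by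
    refine (LSeriesSummable_vonMangoldt (s := 1 + δ) (by simp [hδ])).norm.congr fun n => ?_
    rw [LSeries.norm_term_eq]
    rcases eq_or_ne n 0 with rfl | hn
    · simp
    · simp only [hn, if_false, Complex.norm_real, Real.norm_eq_abs,
        abs_of_nonneg vonMangoldt_nonneg]
      rw [Real.rpow_neg (Nat.cast_nonneg n), div_eq_mul_inv]
      simp
  have hterm : ∀ (t : ℝ) (n : ℕ),
      LSeries.term (fun n => (vonMangoldt n : ℂ)) (1 + δ + Complex.I * t) n =
        ((vonMangoldt n * (n : ℝ) ^ (-(1 + δ)) : ℝ) : ℂ) *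
          Complex.exp (Complex.I * t * (-Real.log n : ℝ)) := by
    intro t n
    rcases eq_or_ne n 0 with rfl | hn
    · simp
    · have hn' : (n : ℂ) ≠ 0 := by exact_mod_cast hn
      rw [LSeries.term_of_ne_zero hn, div_eq_mul_inv, ← Complex.cpow_neg, neg_add,
        Complex.cpow_add _ _ hn', Complex.ofReal_mul, Complex.ofReal_cpow (Nat.cast_nonneg n),
        Complex.cpow_def_of_ne_zero hn' (-(Complex.I * t)), ← Complex.natCast_log]
      push_cast
      rw [mul_assoc (vonMangoldt n : ℂ)]
      congr 3
      ring
  have key : HasSum (fun n : ℕ => ∫ t in (0 : ℝ)..T,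
      ((1 - t / T : ℝ) : ℂ) * Complex.exp (Complex.I * t * L) *
        LSeries.term (fun n => (vonMangoldt n : ℂ)) (1 + δ + Complex.I * t) n)
      (∫ t in (0 : ℝ)..T, ((1 - t / T : ℝ) : ℂ) * Complex.exp (Complex.I * t * L) *
        LSeries (fun n => (vonMangoldt n : ℂ)) (1 + δ + Complex.I * t)) := by
    apply intervalIntegral.hasSum_integral_of_dominated_convergence
      (fun n _ => vonMangoldt n * (n : ℝ) ^ (-(1 + δ)))
    · intro n
      simp_rw [hterm]
      exact Continuous.aestronglyMeasurable (by fun_prop)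
    · intro n
      refine Eventually.of_forall fun t ht => ?_
      rw [Set.uIoc_of_le hT.le] at ht
      have h1 : 0 ≤ t / T := div_nonneg ht.1.le hT.le
      have h2 : t / T ≤ 1 := (div_le_one hT).2 ht.2
      have h3 : ∀ a b : ℝ, ‖Complex.exp (Complex.I * a * b)‖ = 1 := by
        intro a b
        rw [show Complex.I * a * b = ((a * b : ℝ) : ℂ) * Complex.I by push_cast; ring,
          Complex.norm_exp_ofReal_mul_I]
      have h4 : 0 ≤ vonMangoldt n * (n : ℝ) ^ (-(1 + δ)) :=
        mul_nonneg vonMangoldt_nonneg (by positivity)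
      rw [hterm, norm_mul, norm_mul, norm_mul, h3, h3, Complex.norm_real, Complex.norm_real,
        Real.norm_of_nonneg h4, Real.norm_of_nonneg (by linarith)]
      nlinarith
    · exact Eventually.of_forall fun _ _ => hsum
    · simp
    · refine Eventually.of_forall fun t _ => HasSum.mul_left _ ?_
      exact (LSeriesSummable_vonMangoldt (hs t)).LSeriesHasSum
  convert! Complex.hasSum_re key using 2 with n
  rw [← fejer_neg, ← re_integral_exp_eq_fejer, ← Complex.re_ofReal_mul,
    ← intervalIntegral.integral_const_mul]
  congr 2 with t
  have e : Complex.exp (Complex.I * t * (-(Real.log n - L) : ℝ)) =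
      Complex.exp (Complex.I * t * L) * Complex.exp (Complex.I * t * (-Real.log n : ℝ)) := by
    rw [← Complex.exp_add]
    congr 1
    push_cast
    ring
  rw [hterm, e]
  ring

open MeasureTheory in
lemma integral_exp_mul_fejer {T δ : ℝ} (hT : 0 < T) (hδ : 0 < δ) (L : ℝ) :
    Integrable (fun v => Real.exp (-δ * v) * fejer T (v - L)) (volume.restrict (Set.Ioi 0)) ∧
    ∫ v in Set.Ioi (0 : ℝ), Real.exp (-δ * v) * fejer T (v - L) =
      (∫ t in (0 : ℝ)..T, ((1 - t / T : ℝ) : ℂ) * Complex.exp (Complex.I * t * L) *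
        (1 / (δ + Complex.I * t))).re := by
  set f : ℝ → ℝ → ℂ := fun t v => ((1 - t / T : ℝ) : ℂ) * Complex.exp (Complex.I * t * L) *
    Complex.exp (-(δ + Complex.I * t) * v) with hf
  have hint : Integrable (Function.uncurry f)
      ((volume.restrict (Set.uIoc 0 T)).prod (volume.restrict (Set.Ioi 0))) := by
    have hg : Integrable (fun v : ℝ => Real.exp (-δ * v)) (volume.restrict (Set.Ioi 0)) :=
      integrableOn_exp_mul_Ioi (by linarith) 0
    have h1 : Integrable (fun t : ℝ => (1 - t / T)) (volume.restrict (Set.uIoc 0 T)) :=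
      (intervalIntegrable_iff.1 (Continuous.intervalIntegrable (by fun_prop) 0 T))
    refine (h1.mul_prod hg).mono (Continuous.aestronglyMeasurable (by fun_prop)) ?_
    refine Eventually.of_forall fun ⟨t, v⟩ => le_of_eq ?_
    simp only [Function.uncurry, hf, norm_mul, Complex.norm_real, Complex.norm_exp,
      Real.norm_eq_abs, Real.abs_exp]
    simp
  have hswap := intervalIntegral_integral_swap hint
  have hinner : ∀ v : ℝ, (∫ t in (0 : ℝ)..T, f t v).re = Real.exp (-δ * v) * fejer T (v - L) := by
    intro v
    rw [← fejer_neg, ← re_integral_exp_eq_fejer, ← Complex.re_ofReal_mul,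
      ← intervalIntegral.integral_const_mul]
    congr 2 with t
    have e : Complex.exp (Complex.I * t * L) * Complex.exp (-(δ + Complex.I * t) * v) =
        Complex.exp (-δ * v) * Complex.exp (Complex.I * t * (-(v - L) : ℝ)) := by
      rw [← Complex.exp_add, ← Complex.exp_add]
      congr 1
      push_cast
      ring
    simp only [hf]
    rw [mul_assoc, e]
    push_cast
    ring
  have hint2 : Integrable (fun v => ∫ t in (0 : ℝ)..T, f t v) (volume.restrict (Set.Ioi 0)) := by
    simp_rw [intervalIntegral.integral_of_le hT.le]
    rw [Set.uIoc_of_le hT.le] at hint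
    exact hint.swap.integral_prod_left
  simp_rw [← hinner]
  refine ⟨hint2.re, ?_⟩
  have := Complex.reCLM.integral_comp_comm hint2
  simp only [Complex.reCLM_apply] at this
  rw [this, ← hswap]
  congr 2 with t
  simp only [hf]
  rw [integral_const_mul, integral_exp_mul_complex_Ioi (by simpa using hδ)]
  simp
  left
  rw [← neg_add, neg_div_neg_eq, one_div, add_comm]

open MeasureTheory in
lemma le_integral_exp_mul_fejer {T δ L : ℝ} (hT : 1 ≤ T) (hδ : 0 < δ) (hL : 1 ≤ L) :
    Real.exp (-δ * (L + 1)) / 2 ≤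
      ∫ v in Set.Ioi (0 : ℝ), Real.exp (-δ * v) * fejer T (v - L) := by
  have hT0 : 0 < T := by linarith
  have hT1 : 1 / T ≤ 1 := by rw [div_le_one hT0]; exact hT
  have hT2 : 0 < 1 / T := by positivity
  have hint := (integral_exp_mul_fejer hT0 hδ L).1
  have hsub : Set.Ioc (L - 1 / T) (L + 1 / T) ⊆ Set.Ioi 0 := fun v hv => by
    have := hv.1
    simp only [Set.mem_Ioi]; linarith
  calc Real.exp (-δ * (L + 1)) / 2
      = ∫ _v in Set.Ioc (L - 1 / T) (L + 1 / T), Real.exp (-δ * (L + 1)) * (T / 4) := by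
        rw [setIntegral_const, Real.volume_real_Ioc_of_le (by linarith)]
        simp
        field_simp
        ring
    _ ≤ ∫ v in Set.Ioc (L - 1 / T) (L + 1 / T), Real.exp (-δ * v) * fejer T (v - L) := by
        apply setIntegral_mono_on (integrableOn_const (by simp)) (IntegrableOn.mono_set hint hsub)
          measurableSet_Ioc
        intro v hv
        have hb : |T * (v - L)| ≤ 1 := by
          rw [abs_mul, abs_of_pos hT0, ← le_div_iff₀' hT0, abs_le]
          constructor <;> linarith [hv.1, hv.2]
        have := le_fejer hT0 hb
        have h3 : Real.exp (-δ * (L + 1)) ≤ Real.exp (-δ * v) := by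
          apply Real.exp_le_exp.2
          nlinarith [hv.2]
        gcongr
    _ ≤ _ := by
        apply setIntegral_mono_set hint _ hsub.eventuallyLE
        exact Eventually.of_forall fun v =>
          mul_nonneg (Real.exp_pos _).le (fejer_nonneg hT0 _)

open MeasureTheory in
/-- A form of the Riemann–Lebesgue lemma on a bounded interval. -/
lemma tendsto_intervalIntegral_exp_mul (g : ℝ → ℂ) {T : ℝ} (hT : 0 < T) :
    Tendsto (fun L : ℝ => ∫ t in (0 : ℝ)..T, Complex.exp (Complex.I * t * L) * g t)
      atTop (𝓝 0) := by
  have h1 := Real.zero_at_infty_fourier ((Set.Ioc 0 T).indicator g)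
  have h2 : Tendsto (fun L : ℝ => -(L / (2 * Real.pi))) atTop (cocompact ℝ) :=
    (tendsto_neg_atTop_atBot.comp (tendsto_id.atTop_div_const (by positivity))).mono_right
      atBot_le_cocompact
  refine (h1.comp h2).congr fun L => ?_
  simp only [Function.comp, Real.fourier_eq']
  rw [intervalIntegral.integral_of_le hT.le, ← integral_indicator measurableSet_Ioc]
  congr 1 with t
  simp only [Set.indicator_apply, smul_eq_mul]
  split_ifs
  · congr 2
    have := Real.pi_ne_zero
    simp
    field_simp
  · simp

open ArithmeticFunction in
/-- Lower bound for the Fejér-weighted prime sums, a consequence of the nonvanishing of `ζ` on the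
line `re s = 1`. -/
lemma eventually_le_of_vonMangoldt_fejer_le {T : ℝ} (hT : 1 ≤ T) :
    ∀ᶠ L : ℝ in atTop, ∀ B : ℝ, (∀ δ : ℝ, 0 < δ →
      ∑' n : ℕ, vonMangoldt n * (n : ℝ) ^ (-(1 + δ)) * fejer T (Real.log n - L) ≤ B) →
      1 / 4 ≤ B := by
  have hT0 : 0 < T := by linarith
  obtain ⟨F, hFc, hF⟩ := exists_continuousOn_LSeries_vonMangoldt_sub
  have hG : Continuous fun p : ℝ × ℝ => F (1 + (max p.1 0 : ℝ) + Complex.I * p.2) := by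
    refine hFc.comp_continuous (by fun_prop) fun p => ?_
    simp
  have hlim := tendsto_intervalIntegral_exp_mul
    (fun t => ((1 - t / T : ℝ) : ℂ) * F (1 + Complex.I * t)) hT0
  have hlim' := (Complex.continuous_re.tendsto _).comp hlim
  filter_upwards [hlim'.eventually (lt_mem_nhds (show (-(1 / 4) : ℝ) < (0 : ℂ).re by norm_num)),
    eventually_ge_atTop 1] with L hL1 hL B hB
  set R : ℝ → ℝ := fun δ => (∫ t in (0 : ℝ)..T, ((1 - t / T : ℝ) : ℂ) *
    Complex.exp (Complex.I * t * L) * F (1 + (max δ 0 : ℝ) + Complex.I * t)).re with hR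
  have hRc : Continuous R := by
    refine Complex.continuous_re.comp
      (intervalIntegral.continuous_parametric_intervalIntegral_of_continuous' ?_ _ _)
    refine Continuous.mul (by fun_prop) ?_
    exact hG
  have hR0 : -(1 / 4) < R 0 := by
    convert! hL1 using 1
    simp only [hR, Function.comp]
    congr 2 with t
    simp
    ring
  have hident : ∀ δ : ℝ, 0 < δ → Real.exp (-δ * (L + 1)) / 2 + R δ ≤ B := by
    intro δ hδ
    refine le_trans ?_ (hB δ hδ)
    rw [(hasSum_vonMangoldt_mul_fejer hT0 hδ L).tsum_eq]
    have h1 := le_integral_exp_mul_fejer hT hδ hL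
    rw [(integral_exp_mul_fejer hT0 hδ L).2] at h1
    refine (add_le_add_left h1 _).trans (le_of_eq ?_)
    simp only [hR, max_eq_left hδ.le]
    have hne : ∀ t : ℝ, (δ + Complex.I * t : ℂ) ≠ 0 := fun t h => by
      simpa [hδ.ne'] using congrArg Complex.re h
    rw [← Complex.add_re, ← intervalIntegral.integral_add]
    · congr 2 with t
      rw [← mul_add, hF _ (by simp [hδ])]
      congr 1
      rw [show (1 + δ + Complex.I * t - 1 : ℂ) = δ + Complex.I * t by ring]
      ring
    · refine (Continuous.mul (by fun_prop) ?_).intervalIntegrable _ _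
      exact Continuous.div (by fun_prop) (by fun_prop) hne
    · refine (Continuous.mul (by fun_prop) ?_).intervalIntegrable _ _
      have := hG.comp (show Continuous fun t : ℝ => (δ, t) by fun_prop)
      simpa [Function.comp_def, max_eq_left hδ.le] using this
  have hc : Continuous fun δ : ℝ => Real.exp (-δ * (L + 1)) / 2 + R δ := by fun_prop
  have hc0 : Tendsto (fun δ : ℝ => Real.exp (-δ * (L + 1)) / 2 + R δ) (𝓝[>] 0)
      (𝓝 (1 / 2 + R 0)) := by
    have := (hc.tendsto 0).mono_left (nhdsWithin_le_nhds (s := Set.Ioi 0))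
    simpa using this
  have := le_of_tendsto hc0 (eventually_nhdsWithin_of_forall hident)
  linarith

lemma summable_inv_one_add_int_sq : Summable fun k : ℤ => (1 + (k : ℝ) ^ 2)⁻¹ := by
  have h := (Real.summable_one_div_int_pow (p := 2)).2 (by norm_num)
  refine Summable.of_norm_bounded_eventually h ?_
  refine (Set.finite_singleton (0 : ℤ)).subset fun k hk => ?_
  by_contra hk0
  refine hk ?_
  have : (0 : ℝ) < (k : ℝ) ^ 2 := by
    have : (k : ℝ) ≠ 0 := by exact_mod_cast hk0
    positivity
  change ‖(1 + (k : ℝ) ^ 2)⁻¹‖ ≤ 1 / (k : ℝ) ^ 2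
  rw [Real.norm_of_nonneg (by positivity), one_div]
  exact inv_anti₀ this (by linarith)

open ArithmeticFunction in
lemma sum_vonMangoldt_floor_log_eq_le (s : Finset ℕ) (hs : 0 ∉ s) (L : ℝ) (k : ℤ) :
    ∑ n ∈ s.filter (fun n : ℕ => ⌊Real.log n - L⌋ = k), vonMangoldt n / n ≤
      (Real.log 4 + 4) * Real.exp 1 := by
  have hpos : ∀ n ∈ s, (0 : ℝ) < n := fun n hn =>
    Nat.cast_pos.2 (Nat.pos_of_ne_zero fun h => hs (h ▸ hn))
  calc ∑ n ∈ s.filter (fun n : ℕ => ⌊Real.log n - L⌋ = k), vonMangoldt n / n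
      ≤ ∑ n ∈ s.filter (fun n : ℕ => ⌊Real.log n - L⌋ = k),
          vonMangoldt n * Real.exp (-(L + k)) := by
        refine Finset.sum_le_sum fun n hn => ?_
        rw [Finset.mem_filter, Int.floor_eq_iff] at hn
        rw [div_eq_mul_inv]
        refine mul_le_mul_of_nonneg_left ?_ vonMangoldt_nonneg
        rw [Real.exp_neg]
        refine inv_anti₀ (Real.exp_pos _) ?_
        rw [← Real.le_log_iff_exp_le (hpos n hn.1)]
        linarith [hn.2.1]
    _ ≤ ∑ n ∈ Ioc 0 ⌊Real.exp (L + k + 1)⌋₊, vonMangoldt n * Real.exp (-(L + k)) := by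
        refine Finset.sum_le_sum_of_subset_of_nonneg (fun n hn => ?_)
          fun n _ _ => mul_nonneg vonMangoldt_nonneg (Real.exp_pos _).le
        rw [Finset.mem_filter, Int.floor_eq_iff] at hn
        rw [Finset.mem_Ioc]
        refine ⟨Nat.cast_pos.1 (hpos n hn.1), Nat.le_floor ?_⟩
        rw [← Real.log_le_iff_le_exp (hpos n hn.1)]
        linarith [hn.2.2]
    _ = Chebyshev.psi (Real.exp (L + k + 1)) * Real.exp (-(L + k)) := by
        rw [← Finset.sum_mul]; rfl
    _ ≤ (Real.log 4 + 4) * Real.exp (L + k + 1) * Real.exp (-(L + k)) := by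
        gcongr
        exact Chebyshev.psi_le_const_mul_self (Real.exp_pos _).le
    _ = _ := by
        rw [mul_assoc, ← Real.exp_add]
        congr 2
        ring

open ArithmeticFunction in
lemma exists_sum_vonMangoldt_div_floor_sq_le : ∃ C : ℝ, 0 < C ∧
    ∀ (s : Finset ℕ) (L : ℝ), 0 ∉ s →
      ∑ n ∈ s, vonMangoldt n / n * (1 + (⌊Real.log n - L⌋ : ℝ) ^ 2)⁻¹ ≤ C := by
  have hlog : 0 < Real.log 4 := Real.log_pos (by norm_num)
  refine ⟨(Real.log 4 + 4) * Real.exp 1 * ∑' k : ℤ, (1 + (k : ℝ) ^ 2)⁻¹, ?_, ?_⟩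
  · have := summable_inv_one_add_int_sq.tsum_pos (fun k => by positivity) 0 (by norm_num)
    positivity
  intro s L hs
  classical
  calc ∑ n ∈ s, vonMangoldt n / n * (1 + (⌊Real.log n - L⌋ : ℝ) ^ 2)⁻¹
      = ∑ k ∈ s.image (fun n : ℕ => ⌊Real.log n - L⌋),
          ∑ n ∈ s.filter (fun n : ℕ => ⌊Real.log n - L⌋ = k),
          vonMangoldt n / n * (1 + (⌊Real.log n - L⌋ : ℝ) ^ 2)⁻¹ :=
        (Finset.sum_fiberwise_of_maps_to (fun n hn => Finset.mem_image_of_mem _ hn) _).symm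
    _ ≤ ∑ k ∈ s.image (fun n : ℕ => ⌊Real.log n - L⌋),
          (Real.log 4 + 4) * Real.exp 1 * (1 + (k : ℝ) ^ 2)⁻¹ := by
        refine Finset.sum_le_sum fun k _ => ?_
        refine le_trans (le_of_eq ?_) (mul_le_mul_of_nonneg_right
          (sum_vonMangoldt_floor_log_eq_le s hs L k) (by positivity))
        rw [Finset.sum_mul]
        refine Finset.sum_congr rfl fun n hn => ?_
        rw [(Finset.mem_filter.1 hn).2]
    _ ≤ _ := by
        rw [← Finset.mul_sum]
        refine mul_le_mul_of_nonneg_left ?_ (by positivity)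
        exact summable_inv_one_add_int_sq.sum_le_tsum _ fun _ _ => by positivity

open ArithmeticFunction in
lemma sum_vonMangoldt_not_prime_fejer_le {T L ε : ℝ} (hT : 0 < T) (hL : 0 ≤ L + ε)
    (s : Finset ℕ) (h : ∀ n ∈ s, n ≠ 0 ∧ ¬ n.Prime ∧ |Real.log n - L| < ε) :
    ∑ n ∈ s, vonMangoldt n / n * fejer T (Real.log n - L) ≤
      T * Real.exp (ε - L) * (2 * Real.exp ((L + ε) / 2) * (L + ε)) := by
  have hpos : ∀ n ∈ s, (0 : ℝ) < n := fun n hn => Nat.cast_pos.2 (Nat.pos_of_ne_zero (h n hn).1)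
  calc ∑ n ∈ s, vonMangoldt n / n * fejer T (Real.log n - L)
      ≤ ∑ n ∈ s, T * Real.exp (ε - L) * vonMangoldt n := by
        refine Finset.sum_le_sum fun n hn => ?_
        have h1 : (n : ℝ)⁻¹ ≤ Real.exp (ε - L) := by
          rw [← neg_sub, Real.exp_neg]
          refine inv_anti₀ (Real.exp_pos _) ?_
          rw [← Real.le_log_iff_exp_le (hpos n hn)]
          linarith [(abs_lt.1 (h n hn).2.2).1]
        have h2 := (le_abs_self _).trans (abs_fejer_le hT (Real.log n - L))
        have h3 := fejer_nonneg hT (Real.log n - L)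
        rw [div_eq_mul_inv, mul_assoc, mul_comm]
        refine mul_le_mul_of_nonneg_right ?_ vonMangoldt_nonneg
        rw [mul_comm]
        gcongr
    _ ≤ ∑ n ∈ Ioc 0 ⌊Real.exp (L + ε)⌋₊ with ¬ n.Prime,
          T * Real.exp (ε - L) * vonMangoldt n := by
        refine Finset.sum_le_sum_of_subset_of_nonneg (fun n hn => ?_)
          fun n _ _ => mul_nonneg (by positivity) vonMangoldt_nonneg
        rw [Finset.mem_filter, Finset.mem_Ioc]
        refine ⟨⟨Nat.pos_of_ne_zero (h n hn).1, Nat.le_floor ?_⟩, (h n hn).2.1⟩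
        rw [← Real.log_le_iff_le_exp (hpos n hn)]
        linarith [(abs_lt.1 (h n hn).2.2).2]
    _ ≤ _ := by
        rw [← Finset.mul_sum, ← Chebyshev.psi_sub_theta_eq_sum_not_prime]
        refine mul_le_mul_of_nonneg_left ?_ (by positivity)
        refine (Chebyshev.psi_sub_theta_le (Real.one_le_exp hL)).trans (le_of_eq ?_)
        rw [Real.log_exp, Real.exp_half]

open ArithmeticFunction in
/-- For every `ε`, all sufficiently large intervals `(e^(L-ε), e^(L+ε))` contain a prime. -/
lemma eventually_exists_prime_abs_log_sub_lt {ε : ℝ} (hε : 0 < ε) (hε1 : ε ≤ 1) :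
    ∀ᶠ L : ℝ in atTop, ∃ p : ℕ, p.Prime ∧ |Real.log p - L| < ε := by
  obtain ⟨C, hC, hsum⟩ := exists_sum_vonMangoldt_div_floor_sq_le
  set T : ℝ := 1 + 160 * C / ε ^ 2 with hT
  have hT1 : 1 ≤ T := by rw [hT]; have : 0 < 160 * C / ε ^ 2 := by positivity
                         linarith
  have hT0 : 0 < T := by linarith
  have hfar : 10 * C / (T * ε ^ 2) ≤ 1 / 16 := by
    rw [div_le_div_iff₀ (by positivity) (by norm_num), hT]
    have : (1 + 160 * C / ε ^ 2) * ε ^ 2 = ε ^ 2 + 160 * C := by field_simp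
    rw [this]
    nlinarith [sq_nonneg ε]
  have hnear : Tendsto (fun L : ℝ =>
      T * Real.exp (ε - L) * (2 * Real.exp ((L + ε) / 2) * (L + ε))) atTop (𝓝 0) := by
    have h2 : Tendsto (fun L : ℝ => L / 2) atTop atTop := tendsto_id.atTop_div_const (by norm_num)
    have h3 := (Real.tendsto_pow_mul_exp_neg_atTop_nhds_zero 1).comp h2
    have h4 := (Real.tendsto_pow_mul_exp_neg_atTop_nhds_zero 0).comp h2
    have h5 := (h3.const_mul (4 * T * Real.exp (3 / 2 * ε))).add
      (h4.const_mul (2 * T * Real.exp (3 / 2 * ε) * ε))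
    simp only [mul_zero, add_zero] at h5
    refine h5.congr fun L => ?_
    have e : Real.exp (ε - L) * Real.exp ((L + ε) / 2) =
        Real.exp (3 / 2 * ε) * Real.exp (-(L / 2)) := by
      rw [← Real.exp_add, ← Real.exp_add]; congr 1; ring
    simp only [Function.comp, pow_one, pow_zero, one_mul]
    calc _ = 2 * T * (L + ε) * (Real.exp (3 / 2 * ε) * Real.exp (-(L / 2))) := by ring
      _ = _ := by rw [← e]; ring
  filter_upwards [eventually_le_of_vonMangoldt_fejer_le hT1, eventually_ge_atTop 1,
    hnear.eventually (gt_mem_nhds (show (0 : ℝ) < 1 / 16 by norm_num))] with L hL hL1 hLn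
  by_contra! hno
  have := hL (1 / 8) fun δ hδ => ?_
  · norm_num at this
  refine Real.tsum_le_of_sum_range_le (fun n => mul_nonneg
    (mul_nonneg vonMangoldt_nonneg (by positivity)) (fejer_nonneg hT0 _)) fun N => ?_
  calc ∑ n ∈ range N, vonMangoldt n * (n : ℝ) ^ (-(1 + δ)) * fejer T (Real.log n - L)
      ≤ ∑ n ∈ range N with n ≠ 0, vonMangoldt n / n * fejer T (Real.log n - L) := by
        rw [Finset.sum_filter]
        refine Finset.sum_le_sum fun n _ => ?_
        split_ifs with hn
        · have hn1 : (1 : ℝ) ≤ n := by exact_mod_cast Nat.one_le_iff_ne_zero.2 hn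
          refine mul_le_mul_of_nonneg_right ?_ (fejer_nonneg hT0 _)
          rw [div_eq_mul_inv, ← Real.rpow_neg_one]
          refine mul_le_mul_of_nonneg_left ?_ vonMangoldt_nonneg
          exact Real.rpow_le_rpow_of_exponent_le hn1 (by linarith)
        · push Not at hn
          simp [hn]
    _ = ∑ n ∈ ((range N).filter (· ≠ 0)).filter (fun n : ℕ => |Real.log n - L| < ε),
            vonMangoldt n / n * fejer T (Real.log n - L) +
        ∑ n ∈ ((range N).filter (· ≠ 0)).filter (fun n : ℕ => ¬ |Real.log n - L| < ε),
            vonMangoldt n / n * fejer T (Real.log n - L) :=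
        (Finset.sum_filter_add_sum_filter_not _ _ _).symm
    _ ≤ 1 / 16 + 1 / 16 := by
        refine add_le_add (le_trans (sum_vonMangoldt_not_prime_fejer_le hT0
          (by linarith) _ fun n hn => ?_) hLn.le) (le_trans ?_ hfar)
        · simp only [Finset.mem_filter] at hn
          exact ⟨hn.1.2, fun hp => absurd hn.2 (not_lt.2 (hno n hp)), hn.2⟩
        · set S := ((range N).filter (· ≠ 0)).filter fun n : ℕ => ¬ |Real.log n - L| < ε
          have hS : 0 ∉ S := by simp [S]
          refine le_trans ?_ (le_trans (mul_le_mul_of_nonneg_left (hsum S L hS)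
            (show 0 ≤ 10 / (T * ε ^ 2) by positivity)) (le_of_eq (by ring)))
          rw [Finset.mul_sum]
          refine Finset.sum_le_sum fun n hn => ?_
          have hu : ε ≤ |Real.log n - L| := not_lt.1 (Finset.mem_filter.1 hn).2
          set u := Real.log n - L
          have hu0 : u ≠ 0 := fun h => by rw [h, abs_zero] at hu; linarith
          rw [mul_left_comm]
          refine mul_le_mul_of_nonneg_left ?_ (div_nonneg vonMangoldt_nonneg (Nat.cast_nonneg n))
          refine (fejer_le_div hT0 hu0).trans ?_
          have h1 := Int.floor_le u
          have h2 := Int.lt_floor_add_one u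
          have h3 : ε ^ 2 ≤ u ^ 2 := by rw [← sq_abs u]; gcongr
          have h4 : (⌊u⌋ : ℝ) ^ 2 ≤ 2 * u ^ 2 + 2 := by nlinarith [sq_nonneg (u + (u - ⌊u⌋))]
          have h5 : ε ^ 2 ≤ 1 := by nlinarith
          rw [← div_eq_mul_inv, div_div, div_le_div_iff₀ (by positivity) (by positivity)]
          have h6 : ε ^ 2 * (1 + (⌊u⌋ : ℝ) ^ 2) ≤ 5 * u ^ 2 := by
            have h7 : ε ^ 2 * (1 + (⌊u⌋ : ℝ) ^ 2) ≤ ε ^ 2 * (3 + 2 * u ^ 2) :=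
              mul_le_mul_of_nonneg_left (by linarith) (sq_nonneg ε)
            nlinarith [sq_nonneg u]
          nlinarith
    _ = 1 / 8 := by norm_num

lemma exists_prime_le_of_real (x : ℝ) : ∃ p : ℕ, p.Prime ∧ x ≤ (p : ℝ) := by
  obtain ⟨p, hp, hp'⟩ := Nat.exists_infinite_primes ⌈x⌉₊
  exact ⟨p, hp', (Nat.le_ceil x).trans (by exact_mod_cast hp)⟩

lemma leastPrime_spec (x : ℝ) : (leastPrime x).Prime ∧ x ≤ (leastPrime x : ℝ) :=
  Nat.sInf_mem (s := {p : ℕ | p.Prime ∧ x ≤ (p : ℝ)}) (exists_prime_le_of_real x)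

/-- The least prime `≥ x` is asymptotic to `x`. -/
lemma tendsto_leastPrime_div : Tendsto (fun x : ℝ => (leastPrime x : ℝ) / x) atTop (𝓝 1) := by
  have key : ∀ ε : ℝ, 0 < ε → ε ≤ 1 →
      ∀ᶠ x : ℝ in atTop, (leastPrime x : ℝ) / x ≤ Real.exp (2 * ε) := by
    intro ε hε hε1
    have h1 : Tendsto (fun x : ℝ => Real.log x + ε) atTop atTop :=
      tendsto_atTop_add_const_right _ _ Real.tendsto_log_atTop
    filter_upwards [h1.eventually (eventually_exists_prime_abs_log_sub_lt hε hε1),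
      eventually_gt_atTop 0] with x ⟨p, hp, hpx⟩ hx
    have hp0 : (0 : ℝ) < p := by exact_mod_cast hp.pos
    rw [abs_lt] at hpx
    have hxp : x ≤ p := (Real.log_le_log_iff hx hp0).1 (by linarith)
    have hle : (leastPrime x : ℝ) ≤ p :=
      Nat.cast_le.2 (Nat.sInf_le (show p ∈ {p : ℕ | p.Prime ∧ x ≤ (p : ℝ)} from ⟨hp, hxp⟩))
    rw [div_le_iff₀ hx]
    refine hle.trans ?_
    rw [← Real.exp_log hp0]
    calc Real.exp (Real.log p) ≤ Real.exp (2 * ε + Real.log x) := Real.exp_le_exp.2 (by linarith)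
      _ = Real.exp (2 * ε) * x := by rw [Real.exp_add, Real.exp_log hx]
  rw [tendsto_order]
  constructor
  · intro a ha
    filter_upwards [eventually_gt_atTop 0] with x hx
    exact ha.trans_le ((one_le_div hx).2 (leastPrime_spec x).2)
  · intro a ha
    have hla : 0 < Real.log a := Real.log_pos ha
    have hε : 0 < min 1 (Real.log a / 4) := by positivity
    filter_upwards [key _ hε (min_le_left _ _)] with x hx
    refine hx.trans_lt ?_
    rw [← Real.lt_log_iff_exp_lt (by linarith)]
    linarith [min_le_right 1 (Real.log a / 4)]

lemma gaussSum'_eq_gaussSum {N : ℕ} [NeZero N] (χ : DirichletCharacter ℂ N) :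
    gaussSum' χ = gaussSum χ ZMod.stdAddChar := by
  have hN : N ≠ 0 := NeZero.ne N
  rw [gaussSum', gaussSum]
  refine Finset.sum_bij' (fun b _ => (b : ZMod N)) (fun a _ => if a = 0 then N else a.val)
    (fun _ _ => Finset.mem_univ _) (fun a _ => ?_) (fun b hb => ?_) (fun a _ => ?_)
    (fun b _ => ?_)
  · rw [Finset.mem_Icc]
    split_ifs with h
    · omega
    · exact ⟨Nat.pos_of_ne_zero fun h0 => h ((ZMod.val_eq_zero a).1 h0), (ZMod.val_lt a).le⟩
  · rw [Finset.mem_Icc] at hb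
    rcases hb.2.eq_or_lt with rfl | h
    · simp
    · rw [if_neg, ZMod.val_natCast_of_lt h]
      rw [ZMod.natCast_eq_zero_iff]
      exact fun hd => absurd (Nat.le_of_dvd (by omega) hd) (by omega)
  · split_ifs with h
    · simp [h]
    · simp
  · have := ZMod.stdAddChar_coe (N := N) (b : ℤ)
    push_cast at this
    rw [this]

lemma gaussSumConj_eq_gaussSum_inv {N : ℕ} [NeZero N] (χ : DirichletCharacter ℂ N) :
    gaussSumConj χ = gaussSum χ⁻¹ ZMod.stdAddChar := by
  rw [← gaussSum'_eq_gaussSum, gaussSumConj, gaussSum']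
  refine Finset.sum_congr rfl fun b _ => ?_
  rw [← MulChar.star_apply' χ, RCLike.star_def]

lemma gaussSum_inv_mul_gaussSum_of_isPrimitive {N : ℕ} [NeZero N] {χ : DirichletCharacter ℂ N}
    (hχ : χ.IsPrimitive) :
    gaussSum χ⁻¹ ZMod.stdAddChar * gaussSum χ ZMod.stdAddChar = χ (-1) * N := by
  have h := congrFun (ZMod.dft_dft (χ : ZMod N → ℂ)) 1
  rw [ZMod.dft_apply] at h
  simp only [hχ.fourierTransform_eq_inv_mul_gaussSum, mul_one, smul_eq_mul] at h
  rw [mul_comm (χ (-1)), ← h, gaussSum, Finset.sum_mul, ← Equiv.sum_comp (Equiv.neg (ZMod N))]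
  refine Finset.sum_congr rfl fun a _ => ?_
  simp only [Equiv.neg_apply]
  ring

lemma sum_inv_apply_mul_apply {N : ℕ} [NeZero N] (a b : ZMod N) :
    ∑ χ : DirichletCharacter ℂ N, χ⁻¹ b * χ a =
      if b = a then (if IsUnit a then (N.totient : ℂ) else 0) else 0 := by
  by_cases hb : IsUnit b
  · have h := DirichletCharacter.sum_char_inv_mul_char_eq ℂ hb a
    have h1 : ∀ χ : DirichletCharacter ℂ N, χ⁻¹ b = χ b⁻¹ := fun χ => by
      rw [MulChar.inv_apply_eq_inv']
      refine inv_eq_of_mul_eq_one_right ?_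
      rw [← map_mul, ZMod.mul_inv_of_unit b hb, map_one]
    simp only [h1, h]
    by_cases hab : b = a
    · rw [if_pos hab, if_pos hab, if_pos (hab ▸ hb)]
    · rw [if_neg hab, if_neg hab]
  · simp only [MulChar.map_nonunit _ hb, zero_mul, Finset.sum_const_zero]
    by_cases hab : b = a
    · rw [if_pos hab, if_neg (hab ▸ hb)]
    · rw [if_neg hab]

lemma sum_gaussSum_inv_mul_apply {N : ℕ} [NeZero N] (ψ : AddChar (ZMod N) ℂ) (a : ZMod N) :
    ∑ χ : DirichletCharacter ℂ N, gaussSum χ⁻¹ ψ * χ a =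
      if IsUnit a then N.totient * ψ a else 0 := by
  simp only [gaussSum, Finset.sum_mul]
  rw [Finset.sum_comm]
  calc ∑ b, ∑ χ : DirichletCharacter ℂ N, χ⁻¹ b * ψ b * χ a
      = ∑ b, ψ b * ∑ χ : DirichletCharacter ℂ N, χ⁻¹ b * χ a := by
        refine Finset.sum_congr rfl fun b _ => ?_
        rw [Finset.mul_sum]
        exact Finset.sum_congr rfl fun χ _ => by ring
    _ = _ := by
        simp only [sum_inv_apply_mul_apply, mul_ite, mul_zero, Finset.sum_ite_eq',
          Finset.mem_univ, if_true]
        simp only [mul_comm]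

open Classical in
/-- Orthogonality of the even characters against their Gauss sums. -/
lemma sum_even_gaussSum_inv_mul_apply {N : ℕ} [NeZero N] (a : ZMod N) :
    ∑ χ : DirichletCharacter ℂ N with χ (-1) = 1, gaussSum χ⁻¹ ZMod.stdAddChar * χ a =
      if IsUnit a then
        N.totient * ((ZMod.stdAddChar a + ZMod.stdAddChar (-a)) / 2 : ℂ) else 0 := by
  have h1 := sum_gaussSum_inv_mul_apply ZMod.stdAddChar a
  have h2 := sum_gaussSum_inv_mul_apply ZMod.stdAddChar (-a)
  rw [Finset.sum_filter]
  calc _ = ∑ χ : DirichletCharacter ℂ N, (gaussSum χ⁻¹ ZMod.stdAddChar * χ a +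
        gaussSum χ⁻¹ ZMod.stdAddChar * χ (-a)) / 2 := by
        refine Finset.sum_congr rfl fun χ _ => ?_
        have h3 : χ (-a) = χ (-1) * χ a := by rw [← map_mul, neg_one_mul]
        rcases χ.even_or_odd with h | h
        · rw [h3, h, if_pos rfl]; ring
        · rw [h3, h, if_neg (by norm_num)]; ring
    _ = _ := by
        rw [← Finset.sum_div, Finset.sum_add_distrib, h1, h2]
        simp only [IsUnit.neg_iff]
        split_ifs <;> ring

lemma stdAddChar_add_stdAddChar_neg_natCast {N : ℕ} [NeZero N] (p : ℕ) :
    ((ZMod.stdAddChar (p : ZMod N) + ZMod.stdAddChar (-(p : ZMod N))) / 2 : ℂ) =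
      (Real.cos (2 * Real.pi * p / N) : ℂ) := by
  have h1 := ZMod.stdAddChar_coe (N := N) (p : ℤ)
  have h2 := ZMod.stdAddChar_coe (N := N) (-p : ℤ)
  push_cast at h1 h2 ⊢
  rw [h1, h2, Complex.cos]
  congr 3 <;> ring_nf

lemma sum_norm_sq_gaussSum_mulShift {N : ℕ} [NeZero N] (χ : DirichletCharacter ℂ N) :
    ∑ a : ZMod N, ‖gaussSum χ (ZMod.stdAddChar.mulShift a)‖ ^ 2 = N * N.totient := by
  have key : ∀ a : ZMod N, ((‖gaussSum χ (ZMod.stdAddChar.mulShift a)‖ ^ 2 : ℝ) : ℂ) =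
      ∑ x : ZMod N, ∑ z : ZMod N, χ x * χ⁻¹ z * ZMod.stdAddChar (a * (x - z)) := by
    intro a
    rw [Complex.ofReal_pow, ← Complex.mul_conj', ← RCLike.star_def, star_gaussSum_eq, gaussSum,
      gaussSum, Finset.sum_mul_sum]
    refine Finset.sum_congr rfl fun x _ => Finset.sum_congr rfl fun z _ => ?_
    rw [AddChar.inv_apply, AddChar.mulShift_apply, AddChar.mulShift_apply, mul_sub, sub_eq_add_neg,
      AddChar.map_add_eq_mul, mul_neg]
    ring
  rw [← Complex.ofReal_inj, Complex.ofReal_sum, Finset.sum_congr rfl fun a _ => key a,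
    Finset.sum_comm]
  have h2 : ∀ x : ZMod N, ∑ a : ZMod N, ∑ z : ZMod N,
      χ x * χ⁻¹ z * ZMod.stdAddChar (a * (x - z)) = N * (χ x * χ⁻¹ x) := by
    intro x
    rw [Finset.sum_comm]
    simp only [← Finset.mul_sum, AddChar.sum_mulShift _ (ZMod.isPrimitive_stdAddChar N),
      sub_eq_zero, Nat.cast_ite, mul_ite, ZMod.card, Nat.cast_zero, mul_zero, Finset.sum_ite_eq,
      Finset.mem_univ, if_true]
    ring
  rw [Finset.sum_congr rfl fun x _ => h2 x, ← Finset.mul_sum]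
  have h3 : ∀ x : ZMod N, χ x * χ⁻¹ x = (1 : DirichletCharacter ℂ N) x := fun x => by
    rw [← MulChar.mul_apply, mul_inv_cancel]
  simp only [h3, MulChar.sum_one_eq_card_units, ZMod.card_units_eq_totient]
  push_cast
  rfl

lemma norm_gaussSum_one_sq_le {N : ℕ} [NeZero N] :
    ‖gaussSum (1 : DirichletCharacter ℂ N) ZMod.stdAddChar‖ ^ 2 ≤ N := by
  set g := gaussSum (1 : DirichletCharacter ℂ N) ZMod.stdAddChar
  have h1 : ∑ _u : (ZMod N)ˣ, ‖g‖ ^ 2 ≤ N * N.totient := by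
    rw [← sum_norm_sq_gaussSum_mulShift (1 : DirichletCharacter ℂ N)]
    have h2 : ∀ u : (ZMod N)ˣ, ‖g‖ ^ 2 =
        ‖gaussSum (1 : DirichletCharacter ℂ N) (ZMod.stdAddChar.mulShift (u : ZMod N))‖ ^ 2 := by
      intro u
      rw [gaussSum_mulShift_eq]
      simp [g]
    rw [Finset.sum_congr rfl fun u _ => h2 u]
    rw [← Finset.sum_image (f := fun a : ZMod N =>
      ‖gaussSum (1 : DirichletCharacter ℂ N) (ZMod.stdAddChar.mulShift a)‖ ^ 2)
      (g := fun u : (ZMod N)ˣ => (u : ZMod N)) fun u _ v _ h => Units.ext h]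
    exact Finset.sum_le_sum_of_subset_of_nonneg (Finset.subset_univ _) fun _ _ _ => by positivity
  rw [Finset.sum_const, Finset.card_univ, ZMod.card_units_eq_totient, nsmul_eq_mul, mul_comm] at h1
  exact le_of_mul_le_mul_right h1 (by exact_mod_cast Nat.totient_pos.2 (NeZero.pos N))

lemma not_isPrimitive_one {N : ℕ} (hN : 2 ≤ N) : ¬ (1 : DirichletCharacter ℂ N).IsPrimitive := by
  have : NeZero N := ⟨by omega⟩
  rw [DirichletCharacter.isPrimitive_def, DirichletCharacter.conductor_one]
  omega

/-- The contribution of a single modulus to `Q₊ + E₊`. -/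
lemma finsum_primitive_add_finsum_imprimitive {N : ℕ} (hN : 2 ≤ N) (p : ℕ) :
    (∑ᶠ χ ∈ {χ : DirichletCharacter ℂ N | χ.IsPrimitive ∧ χ (-1) = 1},
        χ (p : ZMod N) / gaussSum' χ) +
      (Complex.ofReal (1 / (N : ℝ))) *
        ∑ᶠ χ ∈ {χ : DirichletCharacter ℂ N | ¬χ.IsPrimitive ∧ χ ≠ 1 ∧ χ (-1) = 1},
          gaussSumConj χ * χ (p : ZMod N) =
    (Complex.ofReal (1 / (N : ℝ))) * ((if N.Coprime p then
        ((N.totient * Real.cos (2 * Real.pi * p / N) : ℝ) : ℂ) else 0) -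
      gaussSumConj (1 : DirichletCharacter ℂ N) * (1 : DirichletCharacter ℂ N) (p : ZMod N)) := by
  classical
  have : NeZero N := ⟨by omega⟩
  have hN0 : (N : ℂ) ≠ 0 := NeZero.ne _
  have hE := sum_even_gaussSum_inv_mul_apply (p : ZMod N)
  simp only [stdAddChar_add_stdAddChar_neg_natCast, ZMod.isUnit_iff_coprime] at hE
  have hE' : (if N.Coprime p then
      ((N.totient * Real.cos (2 * Real.pi * p / N) : ℝ) : ℂ) else 0) =
      ∑ χ : DirichletCharacter ℂ N, if χ (-1) = 1 then gaussSumConj χ * χ (p : ZMod N) else 0 := by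
    simp only [gaussSumConj_eq_gaussSum_inv]
    rw [← Finset.sum_filter, hE]
    simp only [Nat.coprime_comm (n := p)]
    push_cast
    rfl
  have h1 : gaussSumConj (1 : DirichletCharacter ℂ N) * (1 : DirichletCharacter ℂ N) (p : ZMod N) =
      ∑ χ : DirichletCharacter ℂ N, if χ = 1 then gaussSumConj χ * χ (p : ZMod N) else 0 := by
    simp
  rw [hE', h1, ← Finset.sum_sub_distrib, finsum_mem_eq_toFinset_sum, finsum_mem_eq_toFinset_sum,
    Set.toFinset_ofPred, Set.toFinset_ofPred, Finset.sum_filter, Finset.sum_filter, Finset.mul_sum,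
    Finset.mul_sum, ← Finset.sum_add_distrib]
  refine Finset.sum_congr rfl fun χ _ => ?_
  by_cases hχ1 : χ = 1
  · subst hχ1
    have hp := not_isPrimitive_one hN
    have he : (1 : DirichletCharacter ℂ N) (-1) = 1 := MulChar.one_apply (isUnit_one.neg)
    simp [hp, he]
  by_cases hp : χ.IsPrimitive
  · by_cases he : χ (-1) = 1
    · have hg := gaussSum_inv_mul_gaussSum_of_isPrimitive hp
      rw [he, one_mul, ← gaussSumConj_eq_gaussSum_inv, ← gaussSum'_eq_gaussSum] at hg
      have hg0 : gaussSum' χ ≠ 0 := right_ne_zero_of_mul (hg ▸ hN0)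
      simp only [hp, he, hχ1, and_self, not_true, false_and, if_true, if_false, sub_zero, mul_zero,
        add_zero]
      push_cast
      field_simp
      rw [← hg]
      ring
    · simp [he, hχ1]
  · by_cases he : χ (-1) = 1
    · simp [hp, he, hχ1]
    · simp [he, hχ1]

lemma norm_gaussSumConj_one_mul_le {N : ℕ} (hN : N ≠ 0) (a : ZMod N) :
    ‖gaussSumConj (1 : DirichletCharacter ℂ N) * (1 : DirichletCharacter ℂ N) a‖ ≤ √N := by
  have : NeZero N := ⟨hN⟩
  rw [norm_mul, gaussSumConj_eq_gaussSum_inv, inv_one]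
  refine (mul_le_of_le_one_right (norm_nonneg _) (DirichletCharacter.norm_le_one _ _)).trans ?_
  exact Real.le_sqrt_of_sq_le norm_gaussSum_one_sq_le

section RiemannSums

variable {g : ℝ → ℝ} {B c : ℝ}

lemma abs_riemannSum_le (hB : ∀ t, |g t| ≤ B) {Y : ℝ} (hc : 0 ≤ c) (hY : 0 < Y) :
    |1 / Y * ∑ m ∈ Ioc 0 ⌊c * Y⌋₊, g (m / Y)| ≤ c * B := by
  have hB0 : 0 ≤ B := (abs_nonneg _).trans (hB 0)
  rw [abs_mul, abs_of_pos (by positivity)]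
  calc 1 / Y * |∑ m ∈ Ioc 0 ⌊c * Y⌋₊, g (m / Y)| ≤ 1 / Y * (c * Y * B) := by
        refine mul_le_mul_of_nonneg_left ?_ (by positivity)
        refine (Finset.abs_sum_le_sum_abs _ _).trans ((Finset.sum_le_sum fun m _ => hB _).trans ?_)
        rw [Finset.sum_const, Nat.card_Ioc, nsmul_eq_mul, Nat.sub_zero]
        exact mul_le_mul_of_nonneg_right (Nat.floor_le (by positivity)) hB0
    _ = c * B := by field_simp

lemma riemannSum_eq_integral (hg : ∀ t, c < t → g t = 0) {Y : ℝ} (hc : 0 ≤ c) (hY : 0 < Y) :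
    1 / Y * ∑ m ∈ Ioc 0 ⌊c * Y⌋₊, g (m / Y) = ∫ t in (0 : ℝ)..c, g (⌈t * Y⌉₊ / Y) := by
  set K := ⌊c * Y⌋₊ with hK
  set G : ℝ → ℝ := fun t => g (⌈t * Y⌉₊ / Y) with hG
  have hKc : (K : ℝ) / Y ≤ c := by
    rw [div_le_iff₀ hY]; exact Nat.floor_le (by positivity)
  have hpiece : ∀ m : ℕ, Set.EqOn (fun _ => g (((m + 1 : ℕ) : ℝ) / Y)) G
      (Set.uIoc ((m : ℝ) / Y) (((m + 1 : ℕ) : ℝ) / Y)) := by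
    intro m t ht
    rw [Set.uIoc_of_le (by gcongr; omega), Set.mem_Ioc, div_lt_iff₀ hY, le_div_iff₀ hY] at ht
    have : ⌈t * Y⌉₊ = m + 1 := by
      rw [Nat.ceil_eq_iff (by omega)]
      exact ⟨by simpa using ht.1, ht.2⟩
    simp only [hG, this]
  have hzero : Set.EqOn (fun _ => (0 : ℝ)) G (Set.uIoc ((K : ℝ) / Y) c) := by
    intro t ht
    rw [Set.uIoc_of_le hKc, Set.mem_Ioc, div_lt_iff₀ hY] at ht
    have h1 : K < ⌈t * Y⌉₊ := Nat.lt_ceil.2 ht.1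
    refine (hg _ ?_).symm
    rw [lt_div_iff₀ hY]
    exact (Nat.floor_lt (by positivity)).1 h1
  have hsum := intervalIntegral.sum_integral_adjacent_intervals (f := G) (μ := MeasureTheory.volume)
    (a := fun m : ℕ => (m : ℝ) / Y) (n := K) fun m _ => intervalIntegrable_const.congr (hpiece m)
  have hint1 : IntervalIntegrable G MeasureTheory.volume 0 ((K : ℝ) / Y) := by
    have := IntervalIntegrable.trans_iterate (f := G) (μ := MeasureTheory.volume)
      (a := fun m : ℕ => (m : ℝ) / Y) (n := K) fun m _ => intervalIntegrable_const.congr (hpiece m)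
    simpa using this
  rw [← intervalIntegral.integral_add_adjacent_intervals hint1
    (intervalIntegrable_const.congr hzero)]
  have h0 : ∫ t in ((K : ℝ) / Y)..c, G t = 0 := by
    rw [intervalIntegral.integral_congr_ae (g := fun _ => (0 : ℝ))
      (Eventually.of_forall fun t ht => (hzero ht).symm)]
    simp
  have h1 : ∫ t in (0 : ℝ)..((K : ℝ) / Y), G t =
      ∑ m ∈ range K, 1 / Y * g (((m + 1 : ℕ) : ℝ) / Y) := by
    simp only [Nat.cast_zero, zero_div] at hsum
    rw [← hsum]
    refine Finset.sum_congr rfl fun m _ => ?_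
    rw [intervalIntegral.integral_congr_ae (g := fun _ => g (((m + 1 : ℕ) : ℝ) / Y))
      (Eventually.of_forall fun t ht => (hpiece m ht).symm), intervalIntegral.integral_const,
      smul_eq_mul]
    congr 1
    push_cast
    ring
  rw [h0, h1, add_zero, ← Finset.mul_sum]
  congr 1
  rw [Finset.range_eq_Ico, Finset.sum_Ico_add' (fun m : ℕ => g ((m : ℝ) / Y)) 0 K 1]
  exact Finset.sum_congr (by ext; simp; omega) fun _ _ => rfl

open MeasureTheory in
lemma tendsto_riemannSum (hgm : Measurable g) (hB : ∀ t, |g t| ≤ B) (hg : ∀ t, c < t → g t = 0)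
    (hcont : ∀ᵐ t, 0 < t → ContinuousAt g t) (hc : 0 ≤ c) :
    Tendsto (fun Y : ℝ => 1 / Y * ∑ m ∈ Ioc 0 ⌊c * Y⌋₊, g (m / Y)) atTop
      (𝓝 (∫ t in (0 : ℝ)..c, g t)) := by
  have hlim : Tendsto (fun Y : ℝ => ∫ t in (0 : ℝ)..c, g (⌈t * Y⌉₊ / Y)) atTop
      (𝓝 (∫ t in (0 : ℝ)..c, g t)) := by
    refine intervalIntegral.tendsto_integral_filter_of_dominated_convergence (fun _ => B)
      (Eventually.of_forall fun Y => ?_) (Eventually.of_forall fun Y => Eventually.of_forall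
        fun t _ => hB _) intervalIntegrable_const ?_
    · refine (hgm.comp ?_).aestronglyMeasurable
      exact (measurable_from_nat.comp
        (Nat.measurable_ceil.comp (measurable_id.mul_const Y))).div_const Y
    · filter_upwards [hcont] with t ht ht0
      rw [Set.uIoc_of_le hc] at ht0
      exact (ht ht0.1).tendsto.comp (tendsto_nat_ceil_mul_div_atTop ht0.1.le)
  refine hlim.congr' ?_
  filter_upwards [eventually_gt_atTop 0] with Y hY
  exact (riemannSum_eq_integral hg hc hY).symm

lemma sum_Ioc_filter_dvd (G : ℕ → ℝ) (K : ℕ) {q : ℕ} (hq : 0 < q) :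
    ∑ n ∈ Ioc 0 K with q ∣ n, G n = ∑ m ∈ Ioc 0 (K / q), G (q * m) := by
  symm
  refine Finset.sum_bij (fun m _ => q * m) (fun m hm => ?_) (fun a _ b _ h => ?_)
    (fun n hn => ?_) fun _ _ => rfl
  · rw [Finset.mem_Ioc, Nat.le_div_iff_mul_le hq] at hm
    rw [Finset.mem_filter, Finset.mem_Ioc]
    exact ⟨⟨Nat.mul_pos hq hm.1, by rw [mul_comm]; exact hm.2⟩, dvd_mul_right _ _⟩
  · exact Nat.eq_of_mul_eq_mul_left hq h
  · rw [Finset.mem_filter, Finset.mem_Ioc] at hn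
    obtain ⟨⟨h0, hK⟩, m, rfl⟩ := hn
    refine ⟨m, ?_, rfl⟩
    rw [Finset.mem_Ioc, Nat.le_div_iff_mul_le hq, mul_comm m]
    exact ⟨Nat.pos_of_mul_pos_left h0, hK⟩

lemma sum_Ioc_sum_divisors_mul (u : ℕ → ℝ) (G : ℕ → ℝ) (K : ℕ) :
    ∑ n ∈ Ioc 0 K, (∑ d ∈ n.divisors, u d) * G n =
      ∑ d ∈ Ioc 0 K, u d * ∑ m ∈ Ioc 0 (K / d), G (d * m) := by
  calc _ = ∑ n ∈ Ioc 0 K, ∑ d ∈ Ioc 0 K, if d ∣ n then u d * G n else 0 := by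
        refine Finset.sum_congr rfl fun n hn => ?_
        rw [← Finset.sum_filter, Finset.sum_mul]
        refine Finset.sum_congr ?_ fun _ _ => rfl
        rw [Finset.mem_Ioc] at hn
        ext d
        simp only [Nat.mem_divisors, Finset.mem_filter, Finset.mem_Ioc]
        refine ⟨fun h => ⟨⟨Nat.pos_of_dvd_of_pos h.1 hn.1, (Nat.le_of_dvd hn.1 h.1).trans hn.2⟩,
          h.1⟩,
          fun h => ⟨h.2, hn.1.ne'⟩⟩
    _ = _ := by
        rw [Finset.sum_comm]
        refine Finset.sum_congr rfl fun d hd => ?_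
        rw [← Finset.sum_filter, sum_Ioc_filter_dvd (fun n => u d * G n) K (Finset.mem_Ioc.1 hd).1,
          Finset.mul_sum]

/-- Mean values of divisor sums `∑ d ∣ n, u d` along a window. -/
lemma tendsto_sum_sum_divisors_mul {u : ℕ → ℝ} (hu : Summable fun d => |u d / d|)
    (hgm : Measurable g) (hB : ∀ t, |g t| ≤ B) (hg : ∀ t, c < t → g t = 0)
    (hcont : ∀ᵐ t, 0 < t → ContinuousAt g t) (hc : 0 ≤ c) :
    Tendsto (fun X : ℝ => 1 / X * ∑ n ∈ Ioc 0 ⌊c * X⌋₊, (∑ d ∈ n.divisors, u d) * g (n / X)) atTop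
      (𝓝 ((∑' d : ℕ, u d / d) * ∫ t in (0 : ℝ)..c, g t)) := by
  set H : ℝ → ℝ := fun Y => 1 / Y * ∑ m ∈ Ioc 0 ⌊c * Y⌋₊, g (m / Y) with hH
  have hHlim : Tendsto H atTop (𝓝 (∫ t in (0 : ℝ)..c, g t)) :=
    tendsto_riemannSum hgm hB hg hcont hc
  have hHle : ∀ Y, 0 < Y → |H Y| ≤ c * B := fun Y hY => abs_riemannSum_le hB hc hY
  have key : ∀ X : ℝ, 0 < X →
      1 / X * ∑ n ∈ Ioc 0 ⌊c * X⌋₊, (∑ d ∈ n.divisors, u d) * g (n / X) =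
        ∑' d : ℕ, u d / d * H (X / d) := by
    intro X hX
    rw [sum_Ioc_sum_divisors_mul, tsum_eq_sum (s := Ioc 0 ⌊c * X⌋₊), Finset.mul_sum]
    · refine Finset.sum_congr rfl fun d hd => ?_
      have hd0 : (d : ℝ) ≠ 0 := Nat.cast_ne_zero.2 (Finset.mem_Ioc.1 hd).1.ne'
      rw [hH]
      simp only
      rw [← mul_div_assoc, Nat.floor_div_natCast]
      have : ∀ m : ℕ, g ((d * m : ℕ) / X) = g (m / (X / d)) := fun m => by
        congr 1; push_cast; field_simp
      simp only [this]
      generalize ∑ m ∈ Ioc 0 (⌊c * X⌋₊ / d), g ((m : ℝ) / (X / d)) = S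
      field_simp
    · intro d hd
      rw [Finset.mem_Ioc, not_and_or, not_lt, not_le] at hd
      rcases hd with hd | hd
      · simp [Nat.le_zero.1 hd]
      · rw [hH]
        simp only
        rw [← mul_div_assoc, Nat.floor_div_natCast, Nat.div_eq_of_lt hd]
        simp
  rw [← tsum_mul_right]
  refine Tendsto.congr' (f₁ := fun X : ℝ => ∑' d : ℕ, u d / d * H (X / d)) ?_ ?_
  · filter_upwards [eventually_gt_atTop 0] with X hX
    exact (key X hX).symm
  refine tendsto_tsum_of_dominated_convergence (hu.mul_right (c * B)) (fun d => ?_) ?_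
  · rcases Nat.eq_zero_or_pos d with rfl | hd
    · simp
    · exact (hHlim.comp (tendsto_id.atTop_div_const (Nat.cast_pos.2 hd))).const_mul _
  · filter_upwards [eventually_gt_atTop 0] with X hX d
    rcases Nat.eq_zero_or_pos d with rfl | hd
    · simp
    · rw [Real.norm_eq_abs, abs_mul]
      exact mul_le_mul_of_nonneg_left (hHle _ (div_pos hX (Nat.cast_pos.2 hd))) (abs_nonneg _)

end RiemannSums

section Moebius

open ArithmeticFunction

lemma hasSum_moebius_div_sq : HasSum (fun n : ℕ => (moebius n : ℝ) / n ^ 2) (6 / Real.pi ^ 2) := by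
  have h2 : 1 < (2 : ℂ).re := by norm_num
  have h := (LSeriesSummable_moebius_iff.2 h2).LSeriesHasSum
  have hL := LSeries_zeta_mul_Lseries_moebius h2
  rw [LSeries_zeta_eq_riemannZeta h2, riemannZeta_two] at hL
  have hpi : (Real.pi : ℂ) ≠ 0 := Complex.ofReal_ne_zero.2 Real.pi_ne_zero
  rw [show LSeries (fun n => (moebius n : ℂ)) 2 = ((6 / Real.pi ^ 2 : ℝ) : ℂ) by
    push_cast
    field_simp at hL ⊢
    linear_combination hL] at h
  rw [← Complex.hasSum_ofReal]
  refine HasSum.congr_fun h fun n => ?_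
  rcases eq_or_ne n 0 with rfl | hn
  · simp
  · rw [LSeries.term_of_ne_zero hn, Complex.cpow_ofNat]
    push_cast
    rfl

lemma summable_odd_moebius_div :
    Summable fun d : ℕ => |(if Odd d then (moebius d : ℝ) / d else 0) / d| := by
  refine Summable.of_nonneg_of_le (fun _ => abs_nonneg _) (fun d => ?_)
    (Real.summable_one_div_nat_pow.2 one_lt_two)
  split_ifs
  · rw [div_div, abs_div, ← sq, abs_of_nonneg (sq_nonneg (d : ℝ))]
    gcongr
    exact_mod_cast abs_moebius_le_one
  · simp

lemma moebius_two_mul (k : ℕ) : moebius (2 * k) = if Odd k then -moebius k else 0 := by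
  split_ifs with h
  · rw [isMultiplicative_moebius.map_mul_of_coprime ((Nat.coprime_two_left).2 h),
      moebius_apply_prime Nat.prime_two, neg_one_mul]
  · rw [Nat.not_odd_iff_even] at h
    obtain ⟨m, rfl⟩ := h
    refine moebius_eq_zero_of_not_squarefree fun hs => ?_
    exact absurd (hs 2 ⟨m, by ring⟩) (by norm_num)

lemma tsum_odd_moebius_div_sq :
    ∑' d : ℕ, (if Odd d then (moebius d : ℝ) / d else 0) / d = 8 / Real.pi ^ 2 := by
  set f : ℕ → ℝ := fun n => (moebius n : ℝ) / n ^ 2 with hf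
  set o : ℕ → ℝ := fun d => (if Odd d then (moebius d : ℝ) / d else 0) / d with ho
  have hfs : Summable f := hasSum_moebius_div_sq.summable
  have hos : Summable o := summable_odd_moebius_div.of_abs
  have hinj2 : Function.Injective fun k : ℕ => 2 * k := fun a b h => by simpa using h
  have hinj1 : Function.Injective fun k : ℕ => 2 * k + 1 := fun a b h => by simpa using h
  have h1 := tsum_even_add_odd (hfs.comp_injective hinj2) (hfs.comp_injective hinj1)
  have h2 := tsum_even_add_odd (hos.comp_injective hinj2) (hos.comp_injective hinj1)
  have h3 : ∀ k, f (2 * k) = -1 / 4 * o k := fun k => by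
    simp only [hf, ho, moebius_two_mul]
    split_ifs
    · push_cast; rw [div_div, ← sq, mul_pow, div_mul_div_comm]; ring
    · simp
  have h4 : ∀ k, o (2 * k) = 0 := fun k => by simp [ho]
  have h5 : ∀ k, o (2 * k + 1) = f (2 * k + 1) := fun k => by
    simp only [ho, hf, odd_two_mul_add_one, if_true]
    rw [div_div, ← sq]
  simp only [h3, h4, h5, tsum_zero, zero_add, tsum_mul_left] at h1 h2
  have h6 : ∑' k, f k = 6 / Real.pi ^ 2 := hasSum_moebius_div_sq.tsum_eq
  rw [h2, h6] at h1
  have : ∑' k, o k = 4 / 3 * (6 / Real.pi ^ 2) := by linarith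
  rw [this]
  ring

lemma totient_div_eq_sum_divisors {n : ℕ} (hn : 0 < n) :
    (n.totient : ℝ) / n = ∑ d ∈ n.divisors, (moebius d : ℝ) / d := by
  have h := (sum_eq_iff_sum_mul_moebius_eq (R := ℝ) (f := fun n => (n.totient : ℝ))
    (g := fun n => (n : ℝ))).1 (fun m _ => by exact_mod_cast Nat.sum_totient m) n hn
  rw [← h, Nat.sum_divisorsAntidiagonal (fun a b => (moebius a : ℝ) * (b : ℝ)), Finset.sum_div]
  refine Finset.sum_congr rfl fun d hd => ?_
  have hdn := Nat.dvd_of_mem_divisors hd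
  have hd0 : (d : ℝ) ≠ 0 := Nat.cast_ne_zero.2 (Nat.pos_of_dvd_of_pos hdn hn).ne'
  have hn0 : (n : ℝ) ≠ 0 := Nat.cast_ne_zero.2 hn.ne'
  rw [Nat.cast_div hdn hd0]
  field_simp

lemma sum_divisors_two_mul_odd (u : ℕ → ℝ) (k : ℕ) :
    ∑ d ∈ (2 * k).divisors, (if Odd d then u d else 0) =
      ∑ d ∈ k.divisors, (if Odd d then u d else 0) := by
  rcases Nat.eq_zero_or_pos k with rfl | hk
  · rfl
  rw [← Finset.sum_filter, ← Finset.sum_filter]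
  refine Finset.sum_congr ?_ fun _ _ => rfl
  ext d
  simp only [Finset.mem_filter, Nat.mem_divisors]
  refine ⟨fun h => ⟨⟨?_, hk.ne'⟩, h.2⟩, fun h => ⟨⟨h.1.1.mul_left _, by omega⟩, h.2⟩⟩
  exact (Nat.coprime_two_right.2 h.2).dvd_of_dvd_mul_left h.1.1

lemma totient_div_of_odd {n : ℕ} (hn : Odd n) : (n.totient : ℝ) / n =
    ∑ d ∈ n.divisors, (if Odd d then (moebius d : ℝ) / d else 0) := by
  rw [totient_div_eq_sum_divisors hn.pos]
  refine Finset.sum_congr rfl fun d hd => ?_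
  rw [if_pos (hn.of_dvd_nat (Nat.dvd_of_mem_divisors hd))]

lemma totient_div_of_even {n : ℕ} (hn0 : 0 < n) (hn : Even n) : (n.totient : ℝ) / n =
    1 / 2 * ∑ d ∈ n.divisors, (if Odd d then (moebius d : ℝ) / d else 0) := by
  induction n using Nat.strong_induction_on with
  | _ n ih =>
    obtain ⟨k, rfl⟩ := hn.two_dvd
    rw [sum_divisors_two_mul_odd]
    rcases Nat.even_or_odd k with hk | hk
    · rw [← ih k (by omega) (by omega) hk, Nat.totient_two_mul_of_even hk]
      push_cast
      rw [mul_div_mul_left _ _ two_ne_zero]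
    · rw [← totient_div_of_odd hk, Nat.totient_two_mul_of_odd hk]
      push_cast
      ring

lemma ite_mod_four_totient_div {n : ℕ} (hn : 0 < n) :
    (if n % 4 ≠ 2 then (n.totient : ℝ) / n else 0) =
      (∑ d ∈ n.divisors, (if Odd d then (moebius d : ℝ) / d else 0)) -
      (if 2 ∣ n then ∑ d ∈ n.divisors, (if Odd d then (moebius d : ℝ) / d else 0) else 0) +
      1 / 2 * (if 4 ∣ n then ∑ d ∈ n.divisors, (if Odd d then (moebius d : ℝ) / d else 0)
        else 0) := by
  by_cases h2 : 2 ∣ n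
  · by_cases h4 : 4 ∣ n
    · rw [if_pos (by omega), if_pos h2, if_pos h4, totient_div_of_even hn (even_iff_two_dvd.2 h2)]
      ring
    · rw [if_neg (by omega), if_pos h2, if_neg h4]
      ring
  · rw [if_pos (by omega), if_neg h2, if_neg (by omega),
      totient_div_of_odd (Nat.not_even_iff_odd.1 (by rwa [even_iff_two_dvd]))]
    ring

/-- Mean value of `φ(n)/n` over `n ≢ 2 (mod 4)`, weighted by a window. -/
lemma tendsto_sum_totient_div_mul {g : ℝ → ℝ} {B c : ℝ}
    (hgm : Measurable g) (hB : ∀ t, |g t| ≤ B) (hg : ∀ t, c < t → g t = 0)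
    (hcont : ∀ᵐ t, 0 < t → ContinuousAt g t) (hc : 0 ≤ c) :
    Tendsto (fun X : ℝ => 1 / X * ∑ n ∈ Ioc 0 ⌊c * X⌋₊,
        (if n % 4 ≠ 2 then (n.totient : ℝ) / n else 0) * g (n / X)) atTop
      (𝓝 (5 / Real.pi ^ 2 * ∫ t in (0 : ℝ)..c, g t)) := by
  set κ : ℕ → ℝ := fun n => ∑ d ∈ n.divisors, (if Odd d then (moebius d : ℝ) / d else 0) with hκ
  set A : ℝ → ℝ := fun X => 1 / X * ∑ n ∈ Ioc 0 ⌊c * X⌋₊, κ n * g (n / X) with hA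
  have hAlim : Tendsto A atTop (𝓝 (8 / Real.pi ^ 2 * ∫ t in (0 : ℝ)..c, g t)) := by
    rw [← tsum_odd_moebius_div_sq]
    exact tendsto_sum_sum_divisors_mul summable_odd_moebius_div hgm hB hg hcont hc
  have hκ2 : ∀ k, κ (2 * k) = κ k := fun k => sum_divisors_two_mul_odd _ k
  have hκ4 : ∀ k, κ (4 * k) = κ k := fun k => by
    rw [show 4 * k = 2 * (2 * k) by ring, hκ2, hκ2]
  have hsub : ∀ q : ℕ, 0 < q → (∀ k, κ (q * k) = κ k) → ∀ X : ℝ,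
      1 / X * ∑ n ∈ Ioc 0 ⌊c * X⌋₊, (if q ∣ n then κ n else 0) * g (n / X) = A (X / q) / q := by
    intro q hq hqκ X
    have hq0 : (q : ℝ) ≠ 0 := Nat.cast_ne_zero.2 hq.ne'
    have h := sum_Ioc_filter_dvd (fun n => κ n * g (n / X)) ⌊c * X⌋₊ hq
    rw [Finset.sum_filter] at h
    simp only [ite_mul, zero_mul]
    rw [h, hA]
    simp only
    rw [← mul_div_assoc, Nat.floor_div_natCast]
    have : ∀ m : ℕ, κ (q * m) * g ((q * m : ℕ) / X) = κ m * g (m / (X / q)) := fun m => by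
      rw [hqκ]
      congr 2
      push_cast
      rw [div_div_eq_mul_div, mul_comm]
    simp only [this]
    generalize ∑ m ∈ Ioc 0 (⌊c * X⌋₊ / q), κ m * g ((m : ℝ) / (X / q)) = S
    field_simp
  have h2 := (hAlim.comp (tendsto_id.atTop_div_const (show (0 : ℝ) < 2 by norm_num))).div_const 2
  have h4 := (hAlim.comp (tendsto_id.atTop_div_const (show (0 : ℝ) < 4 by norm_num))).div_const 4
  have hcomb := (hAlim.sub h2).add (h4.const_mul (1 / 2))
  refine Tendsto.congr (fun X => ?_) (hcomb.trans (le_of_eq (congrArg 𝓝 (by ring))))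
  have e2 := hsub 2 two_pos hκ2 X
  have e4 := hsub 4 four_pos hκ4 X
  simp only [Function.comp, id]
  push_cast at e2 e4
  rw [← e2, ← e4, hA]
  simp only
  rw [mul_left_comm, ← mul_sub, ← mul_add, Finset.mul_sum, ← Finset.sum_sub_distrib,
    ← Finset.sum_add_distrib]
  congr 1
  refine Finset.sum_congr rfl fun n hn => ?_
  rw [ite_mod_four_totient_div (Finset.mem_Ioc.1 hn).1]
  ring

end Moebius

lemma tendsto_sum_totient_div_mul_cos {y c : ℝ} (hc : 1 < c) :
    Tendsto (fun X : ℝ => 1 / X * ∑ n ∈ Ioc 0 ⌊c * X⌋₊,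
        (if n % 4 ≠ 2 then (n.totient : ℝ) / n else 0) *
          (Set.Icc 1 c).indicator (fun t => Real.cos (2 * Real.pi * y / t)) (n / X)) atTop
      (𝓝 (5 / Real.pi ^ 2 * ∫ t in (1 : ℝ)..c, Real.cos (2 * Real.pi * y / t))) := by
  set f : ℝ → ℝ := fun t => Real.cos (2 * Real.pi * y / t) with hf
  have hfm : Measurable f := by fun_prop
  have hint : ∫ t in (0 : ℝ)..c, (Set.Icc 1 c).indicator f t = ∫ t in (1 : ℝ)..c, f t := by
    rw [intervalIntegral.integral_of_le (by linarith), intervalIntegral.integral_of_le hc.le,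
      MeasureTheory.setIntegral_indicator measurableSet_Icc,
      ← MeasureTheory.integral_Icc_eq_integral_Ioc]
    congr 2
    ext t
    simp only [Set.mem_inter_iff, Set.mem_Ioc, Set.mem_Icc]
    constructor
    · tauto
    · exact fun h => ⟨⟨by linarith [h.1], h.2⟩, h⟩
  rw [← hint]
  refine tendsto_sum_totient_div_mul (B := 1) (hfm.indicator measurableSet_Icc) (fun t => ?_)
    (fun t ht => Set.indicator_of_notMem (fun h => ht.not_ge h.2) _) ?_ (by linarith)
  · rw [Set.indicator_apply]
    split_ifs
    · exact Real.abs_cos_le_one _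
    · simp
  · have hnull : MeasureTheory.volume ({1, c} : Set ℝ) = 0 :=
      (Set.toFinite ({1, c} : Set ℝ)).measure_zero _
    filter_upwards [MeasureTheory.measure_eq_zero_iff_ae_notMem.1 hnull] with t ht ht0
    refine ContinuousOn.continuousAt_indicator (fun s hs => ?_) (by rwa [frontier_Icc hc.le])
    rw [interior_Icc] at hs
    have hs0 : s ≠ 0 := by linarith [hs.1]
    exact (Real.continuous_cos.continuousAt.comp
      (continuousAt_const.div continuousAt_id hs0)).continuousWithinAt

/-- The combined contribution of a modulus is close to `φ(N)/N cos(2πyX/N)`. -/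
lemma norm_finsum_add_finsum_sub_le {N p : ℕ} {X y : ℝ} (hp : p.Prime) (hX : 2 ≤ X)
    (hN : X ≤ N) :
    ‖(∑ᶠ χ ∈ {χ : DirichletCharacter ℂ N | χ.IsPrimitive ∧ χ (-1) = 1},
        χ ((p : ℕ) : ZMod N) / gaussSum' χ) + (Complex.ofReal (1 / (N : ℝ))) *
        (∑ᶠ χ ∈ {χ : DirichletCharacter ℂ N | ¬χ.IsPrimitive ∧ χ ≠ 1 ∧ χ (-1) = 1},
          gaussSumConj χ * χ ((p : ℕ) : ZMod N)) -
      Complex.ofReal ((N.totient : ℝ) / N * Real.cos (2 * Real.pi * y / (N / X)))‖ ≤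
      2 * Real.pi * |p / X - y| + 1 / √X + (if p ∣ N then 1 else 0) := by
  have hX0 : 0 < X := by linarith
  have hN0 : (0 : ℝ) < N := by linarith
  have hN2 : 2 ≤ N := by exact_mod_cast hX.trans hN
  have htot : (N.totient : ℝ) / N ≤ 1 :=
    (div_le_one hN0).2 (Nat.cast_le.2 (Nat.totient_le N))
  have htot0 : (0 : ℝ) ≤ (N.totient : ℝ) / N := by positivity
  rw [finsum_primitive_add_finsum_imprimitive hN2]
  have hprinc : ‖Complex.ofReal (1 / (N : ℝ)) *
      (gaussSumConj (1 : DirichletCharacter ℂ N) * (1 : DirichletCharacter ℂ N) (p : ZMod N))‖ ≤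
      1 / √X := by
    rw [norm_mul, Complex.norm_real, Real.norm_of_nonneg (by positivity)]
    calc 1 / (N : ℝ) * _ ≤ 1 / (N : ℝ) * √N :=
          mul_le_mul_of_nonneg_left (norm_gaussSumConj_one_mul_le (by omega) _) (by positivity)
      _ = 1 / √N := by
          rw [one_div_mul_eq_div, Real.sqrt_div_self']
      _ ≤ 1 / √X := by
          have := Real.sqrt_pos.2 hX0
          gcongr
  have hmain : ‖Complex.ofReal (1 / (N : ℝ)) *
      (if N.Coprime p then ((N.totient * Real.cos (2 * Real.pi * p / N) : ℝ) : ℂ) else 0) -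
      Complex.ofReal ((N.totient : ℝ) / N * Real.cos (2 * Real.pi * y / (N / X)))‖ ≤
      2 * Real.pi * |p / X - y| + (if p ∣ N then 1 else 0) := by
    by_cases h : p ∣ N
    · rw [if_neg fun h' => (hp.coprime_iff_not_dvd.1 h'.symm) h, if_pos h, mul_zero, zero_sub,
        norm_neg, Complex.norm_real, norm_mul, Real.norm_of_nonneg htot0, Real.norm_eq_abs]
      have := mul_le_one₀ htot (abs_nonneg _)
        (Real.abs_cos_le_one (2 * Real.pi * y / (N / X)))
      exact this.trans (le_add_of_nonneg_left (by positivity))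
    · rw [if_pos (hp.coprime_iff_not_dvd.2 h).symm, if_neg h, add_zero, ← Complex.ofReal_mul,
        ← Complex.ofReal_sub, Complex.norm_real, ← mul_assoc, one_div_mul_eq_div, ← mul_sub,
        norm_mul, Real.norm_of_nonneg htot0]
      calc (N.totient : ℝ) / N * ‖Real.cos (2 * Real.pi * p / N) -
            Real.cos (2 * Real.pi * y / (N / X))‖
          ≤ 1 * |2 * Real.pi * p / N - 2 * Real.pi * y / (N / X)| :=
            mul_le_mul htot (Real.abs_cos_sub_cos_le _ _) (norm_nonneg _) zero_le_one
        _ = 2 * Real.pi * |p / X - y| * (X / N) := by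
            rw [one_mul, show 2 * Real.pi * p / N - 2 * Real.pi * y / (N / X) =
              2 * Real.pi * (p / X - y) * (X / N) by field_simp, abs_mul, abs_mul,
              abs_of_pos Real.two_pi_pos, abs_of_pos (div_pos hX0 hN0)]
        _ ≤ 2 * Real.pi * |p / X - y| :=
            mul_le_of_le_one_right (by positivity) ((div_le_one hN0).2 hN)
  rw [mul_sub, sub_right_comm]
  refine (norm_sub_le _ _).trans ((add_le_add hmain hprinc).trans (le_of_eq ?_))
  ring

lemma sum_Ioc_ite_dvd_le {M p : ℕ} :
    ∑ n ∈ Ioc 0 M, (if p ∣ n then (1 : ℝ) else 0) ≤ (M : ℝ) / p := by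
  rw [Finset.sum_boole, Nat.Ioc_filter_dvd_card_eq_div]
  exact Nat.cast_div_le

lemma norm_Qplus_add_Eplus_sub_le {y c X : ℝ} (hy : 0 < y) (hc : 1 < c) (hX : 2 ≤ X) :
    ‖Qplus y X c + Eplus y X c - Complex.ofReal (1 / X * ∑ n ∈ Ioc 0 ⌊c * X⌋₊,
        (if n % 4 ≠ 2 then (n.totient : ℝ) / n else 0) *
          (Set.Icc 1 c).indicator (fun t => Real.cos (2 * Real.pi * y / t)) (n / X))‖ ≤
      c * (2 * Real.pi * |leastPrime (y * X) / X - y| + 1 / √X) + c / y / X := by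
  have hX0 : 0 < X := by linarith
  obtain ⟨hp, hyp⟩ := leastPrime_spec (y * X)
  set p := leastPrime (y * X) with hpdef
  have hS : (Finset.range (⌊c * X⌋₊ + 1)).filter
      (fun N : ℕ => 0 < N ∧ X ≤ (N : ℝ) ∧ (N : ℝ) ≤ c * X ∧ N % 4 ≠ 2) =
      (Ioc 0 ⌊c * X⌋₊).filter fun N : ℕ => N % 4 ≠ 2 ∧ X ≤ (N : ℝ) := by
    ext N
    simp only [Finset.mem_filter, Finset.mem_range, Finset.mem_Ioc, Nat.lt_succ_iff]
    have := Nat.le_floor_iff (a := c * X) (n := N) (by positivity)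
    tauto
  have hmain : ∑ n ∈ Ioc 0 ⌊c * X⌋₊, (if n % 4 ≠ 2 then (n.totient : ℝ) / n else 0) *
      (Set.Icc 1 c).indicator (fun t => Real.cos (2 * Real.pi * y / t)) (n / X) =
      ∑ n ∈ (Ioc 0 ⌊c * X⌋₊).filter fun N : ℕ => N % 4 ≠ 2 ∧ X ≤ (N : ℝ),
        (n.totient : ℝ) / n * Real.cos (2 * Real.pi * y / (n / X)) := by
    rw [Finset.sum_filter]
    refine Finset.sum_congr rfl fun n hn => ?_
    have hn' : (n : ℝ) / X ≤ c := by
      rw [div_le_iff₀ hX0, ← Nat.le_floor_iff (by positivity)]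
      exact (Finset.mem_Ioc.1 hn).2
    simp only [Set.indicator_apply, Set.mem_Icc, one_le_div hX0, hn', and_true]
    by_cases h1 : n % 4 ≠ 2 <;> by_cases h2 : X ≤ n <;> simp [h1, h2]
  rw [hmain, Qplus, Eplus, hS, ← mul_add, ← Finset.sum_add_distrib, Complex.ofReal_mul,
    Complex.ofReal_sum, ← mul_sub, ← Finset.sum_sub_distrib, norm_mul, Complex.norm_real,
    Real.norm_of_nonneg (by positivity)]
  set D := 2 * Real.pi * |p / X - y| + 1 / √X with hD
  have hD0 : 0 ≤ D := by positivity
  have hfl : (⌊c * X⌋₊ : ℝ) ≤ c * X := Nat.floor_le (by positivity)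
  calc 1 / X * _ ≤ 1 / X * ∑ n ∈ (Ioc 0 ⌊c * X⌋₊).filter fun N : ℕ => N % 4 ≠ 2 ∧ X ≤ (N : ℝ),
        (D + (if p ∣ n then 1 else 0)) := by
        refine mul_le_mul_of_nonneg_left (norm_sum_le_of_le _ fun n hn => ?_) (by positivity)
        exact norm_finsum_add_finsum_sub_le hp hX (Finset.mem_filter.1 hn).2.2
    _ ≤ 1 / X * ∑ n ∈ Ioc 0 ⌊c * X⌋₊, (D + (if p ∣ n then 1 else 0)) := by
        refine mul_le_mul_of_nonneg_left (Finset.sum_le_sum_of_subset_of_nonneg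
          (Finset.filter_subset _ _) fun n _ _ => ?_) (by positivity)
        split_ifs <;> positivity
    _ ≤ 1 / X * (c * X * D + c / y) := by
        refine mul_le_mul_of_nonneg_left ?_ (by positivity)
        rw [Finset.sum_add_distrib, Finset.sum_const, Nat.card_Ioc, nsmul_eq_mul, Nat.sub_zero]
        refine add_le_add (mul_le_mul_of_nonneg_right hfl hD0) (sum_Ioc_ite_dvd_le.trans ?_)
        calc (⌊c * X⌋₊ : ℝ) / p ≤ c * X / (y * X) := by gcongr
          _ = c / y := mul_div_mul_right _ _ hX0.ne'
    _ = c * D + c / y / X := by field_simp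

lemma tendsto_leastPrime_mul_div {y : ℝ} (hy : 0 < y) :
    Tendsto (fun X : ℝ => (leastPrime (y * X) : ℝ) / X) atTop (𝓝 y) := by
  have h := (tendsto_leastPrime_div.comp (tendsto_id.const_mul_atTop hy)).const_mul y
  rw [mul_one] at h
  refine h.congr fun X => ?_
  simp only [Function.comp, id]
  rw [← mul_div_assoc, mul_div_mul_left _ _ hy.ne']

theorem murmuration_composite_conductors_geometric (y c : ℝ) (hy : 0 < y) (hc : 1 < c) :
    Tendsto (fun X : ℝ => Qplus y X c + Eplus y X c) atTop
      (𝓝 (Complex.ofReal ((5 / Real.pi ^ 2) *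
        ∫ x in (1:ℝ)..c, Real.cos (2 * Real.pi * y / x)))) := by
  have herr : Tendsto (fun X : ℝ => c * (2 * Real.pi * |leastPrime (y * X) / X - y| + 1 / √X) +
      c / y / X) atTop (𝓝 0) := by
    have h1 := (((tendsto_leastPrime_mul_div hy).sub_const y).abs).const_mul (2 * Real.pi)
    have h2 : Tendsto (fun X : ℝ => 1 / √X) atTop (𝓝 0) :=
      Real.tendsto_sqrt_atTop.const_div_atTop 1
    have h3 : Tendsto (fun X : ℝ => c / y / X) atTop (𝓝 0) := tendsto_id.const_div_atTop _
    simpa using ((h1.add h2).const_mul c).add h3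
  have hdiff := squeeze_zero_norm'
    ((eventually_ge_atTop 2).mono fun X hX => norm_Qplus_add_Eplus_sub_le hy hc hX) herr
  have h := hdiff.add
    ((Complex.continuous_ofReal.tendsto _).comp (tendsto_sum_totient_div_mul_cos (y := y) hc))
  rw [zero_add] at h
  exact h.congr fun X => sub_add_cancel _ _
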